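/- arXiv:2402.08693 — 5 statements merged into one kernel-verified Lean document; each statement's English description precedes it below -/
import Mathlib

section
/- π = (√3 / 60) · Σ_{n=0}^∞ (2n)! · (130n + 109) / ((7/6)_n · (11/6)_n · (-1296)^n), where the series converges absolutely. -/
open Real

/-- Rising factorial (Pochhammer symbol): `(a)_n = ∏_{i=0}^{n-1} (a + i)`. -/
noncomputable def risingFactorial (a : ℝ) (n : ℕ) : ℝ := ∏ i ∈ Finset.range n, (a + i)

/-- The integral `∫₀¹ x^(2p) (1 - x²)^q dx`, a beta integral after the substitution `t = x²`. -/
noncomputable def evenBetaIntegral (p q : ℕ) : ℝ :=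
  ∫ x in (0 : ℝ)..1, x ^ (2 * p) * (1 - x ^ 2) ^ q

theorem evenBetaIntegral_succ_right_eq_sub (p q : ℕ) :
    evenBetaIntegral p (q + 1) = evenBetaIntegral p q - evenBetaIntegral (p + 1) q := by
  unfold evenBetaIntegral
  rw [← intervalIntegral.integral_sub]
  · congr 1
    ext x
    ring
  · exact Continuous.intervalIntegrable (by fun_prop) _ _
  · exact Continuous.intervalIntegrable (by fun_prop) _ _

theorem evenBetaIntegral_integration_by_parts (p q : ℕ) :
    (2 * p + 1) * evenBetaIntegral p (q + 1) = 2 * (q + 1) * evenBetaIntegral (p + 1) q := by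
  have hderiv (x : ℝ) : HasDerivAt (fun x : ℝ => x ^ (2 * p + 1) * (1 - x ^ 2) ^ (q + 1))
      ((2 * p + 1) * (x ^ (2 * p) * (1 - x ^ 2) ^ (q + 1)) -
        2 * (q + 1) * (x ^ (2 * (p + 1)) * (1 - x ^ 2) ^ q)) x := by
    refine ((hasDerivAt_pow (2 * p + 1) x).mul
      (((hasDerivAt_pow 2 x).const_sub 1).pow (q + 1))).congr_deriv ?_
    simp only [Nat.add_sub_cancel, Pi.pow_apply]
    push_cast
    ring
  have h := intervalIntegral.integral_eq_sub_of_hasDerivAt (a := 0) (b := 1)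
    (fun x _ => hderiv x) (Continuous.intervalIntegrable (by fun_prop) _ _)
  rw [intervalIntegral.integral_sub (Continuous.intervalIntegrable (by fun_prop) _ _)
    (Continuous.intervalIntegrable (by fun_prop) _ _), intervalIntegral.integral_const_mul,
    intervalIntegral.integral_const_mul] at h
  simp only [evenBetaIntegral]
  norm_num at h
  linarith

theorem evenBetaIntegral_succ_left (p q : ℕ) :
    evenBetaIntegral (p + 1) q = (2 * p + 1) / (2 * p + 2 * q + 3) * evenBetaIntegral p q := by
  have h₁ := evenBetaIntegral_succ_right_eq_sub p q
  have h₂ := evenBetaIntegral_integration_by_parts p q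
  rw [h₁] at h₂
  field_simp
  linarith

theorem evenBetaIntegral_succ_right (p q : ℕ) :
    evenBetaIntegral p (q + 1) = 2 * (q + 1) / (2 * p + 2 * q + 3) * evenBetaIntegral p q := by
  rw [evenBetaIntegral_succ_right_eq_sub, evenBetaIntegral_succ_left]
  field_simp
  ring

theorem risingFactorial_succ (a : ℝ) (n : ℕ) :
    risingFactorial a (n + 1) = risingFactorial a n * (a + n) :=
  Finset.prod_range_succ _ _

theorem risingFactorial_pos {a : ℝ} (ha : 0 < a) (n : ℕ) : 0 < risingFactorial a n :=
  Finset.prod_pos fun _ _ => by positivity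

theorem evenBetaIntegral_succ_two_mul (n : ℕ) :
    evenBetaIntegral (n + 1) (2 * n) = (Nat.factorial (2 * n) : ℝ) * (6 * n + 5) /
      (15 * (risingFactorial (7 / 6) n * risingFactorial (11 / 6) n * 27 ^ n)) := by
  induction n with
  | zero => norm_num [evenBetaIntegral, risingFactorial]
  | succ n ih =>
    have h₇ := (risingFactorial_pos (a := 7 / 6) (by norm_num) n).ne'
    have h₁₁ := (risingFactorial_pos (a := 11 / 6) (by norm_num) n).ne'
    rw [show 2 * (n + 1) = 2 * n + 1 + 1 by ring, evenBetaIntegral_succ_right,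
      evenBetaIntegral_succ_right, evenBetaIntegral_succ_left, ih, risingFactorial_succ,
      risingFactorial_succ, Nat.factorial_succ, Nat.factorial_succ]
    push_cast
    have e₁ : (7 / 6 + n : ℝ) ≠ 0 := by positivity
    have e₂ : (11 / 6 + n : ℝ) ≠ 0 := by positivity
    field_simp
    ring

theorem term_eq_integral (n : ℕ) :
    (Nat.factorial (2 * n) : ℝ) * (130 * (n : ℝ) + 109) /
        (risingFactorial (7 / 6) n * risingFactorial (11 / 6) n * (-1296 : ℝ) ^ n) =
      ∫ x in (0 : ℝ)..1,
        15 / 2 * (x ^ 2 * (43 + x ^ 2)) * (-(x ^ 2 * (1 - x ^ 2) ^ 2) / 48) ^ n := by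
  have h : ∫ x in (0 : ℝ)..1,
        15 / 2 * (x ^ 2 * (43 + x ^ 2)) * (-(x ^ 2 * (1 - x ^ 2) ^ 2) / 48) ^ n =
      15 / 2 * (-1 / 48) ^ n *
        (43 * evenBetaIntegral (n + 1) (2 * n) + evenBetaIntegral (n + 1 + 1) (2 * n)) := by
    unfold evenBetaIntegral
    rw [← intervalIntegral.integral_const_mul, ← intervalIntegral.integral_add,
      ← intervalIntegral.integral_const_mul]
    · congr 1
      ext x
      rw [show -(x ^ 2 * (1 - x ^ 2) ^ 2) / 48 = (-1 / 48) * (x ^ 2 * (1 - x ^ 2) ^ 2) by ring,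
        mul_pow, mul_pow, ← pow_mul, ← pow_mul]
      ring
    · exact Continuous.intervalIntegrable (by fun_prop) _ _
    · exact Continuous.intervalIntegrable (by fun_prop) _ _
  have h₇ := (risingFactorial_pos (a := 7 / 6) (by norm_num) n).ne'
  have h₁₁ := (risingFactorial_pos (a := 11 / 6) (by norm_num) n).ne'
  rw [h, evenBetaIntegral_succ_left (n + 1), evenBetaIntegral_succ_two_mul,
    show (-1296 : ℝ) = 27 * (-48) by norm_num, mul_pow,
    show (-1 / 48 : ℝ) = (-48)⁻¹ by norm_num, inv_pow]
  have e : ((-48 : ℝ) ^ n) ≠ 0 := by positivity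
  push_cast
  generalize (-48 : ℝ) ^ n = y at *
  field_simp
  ring

theorem abs_integrand_le {x : ℝ} (hx : x ∈ Set.Icc (0 : ℝ) 1) (n : ℕ) :
    |15 / 2 * (x ^ 2 * (43 + x ^ 2)) * (-(x ^ 2 * (1 - x ^ 2) ^ 2) / 48) ^ n| ≤
      330 * (1 / 48) ^ n := by
  have h₁ : x ^ 2 ≤ 1 := pow_le_one₀ hx.1 hx.2
  have h₂ : (1 - x ^ 2) ^ 2 ≤ 1 := pow_le_one₀ (by linarith) (by nlinarith)
  rw [abs_mul, abs_pow]
  gcongr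
  · rw [abs_of_nonneg (by positivity)]
    nlinarith
  · rw [abs_div, abs_neg, abs_of_nonneg (by positivity), abs_of_pos (by norm_num)]
    gcongr
    exact mul_le_one₀ h₁ (by positivity) h₂

theorem summable_bound : Summable fun n : ℕ => (330 : ℝ) * (1 / 48) ^ n :=
  (summable_geometric_of_lt_one (by norm_num) (by norm_num)).mul_left _

theorem hasSum_integrand {x : ℝ} (hx : x ∈ Set.Icc (0 : ℝ) 1) :
    HasSum (fun n : ℕ => 15 / 2 * (x ^ 2 * (43 + x ^ 2)) * (-(x ^ 2 * (1 - x ^ 2) ^ 2) / 48) ^ n)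
      (180 * (8 * ((x ^ 2 + 4) / ((4 - x ^ 2) ^ 2 + 3 * x ^ 2)) - 6 * (1 / (x ^ 2 + 3)))) := by
  have h₁ : x ^ 2 ≤ 1 := pow_le_one₀ hx.1 hx.2
  have h₂ : (1 - x ^ 2) ^ 2 ≤ 1 := pow_le_one₀ (by linarith) (by nlinarith)
  have hr : |-(x ^ 2 * (1 - x ^ 2) ^ 2) / 48| < 1 := by
    have := mul_le_one₀ h₁ (by positivity) h₂
    have : 0 ≤ x ^ 2 * (1 - x ^ 2) ^ 2 := by positivity
    rw [abs_lt]
    constructor <;> linarith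
  have h := (hasSum_geometric_of_abs_lt_one hr).mul_left (15 / 2 * (x ^ 2 * (43 + x ^ 2)))
  have e₁ : (4 - x ^ 2) ^ 2 + 3 * x ^ 2 ≠ 0 := by nlinarith
  have e₂ : 1 - -(x ^ 2 * (1 - x ^ 2) ^ 2) / 48 =
      (x ^ 2 + 3) * ((4 - x ^ 2) ^ 2 + 3 * x ^ 2) / 48 := by ring
  rw [e₂] at h
  have e₃ : 15 / 2 * (x ^ 2 * (43 + x ^ 2)) *
      ((x ^ 2 + 3) * ((4 - x ^ 2) ^ 2 + 3 * x ^ 2) / 48)⁻¹ =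
      180 * (8 * ((x ^ 2 + 4) / ((4 - x ^ 2) ^ 2 + 3 * x ^ 2)) - 6 * (1 / (x ^ 2 + 3))) := by
    generalize hD : (4 - x ^ 2) ^ 2 + 3 * x ^ 2 = D at e₁
    field_simp
    rw [← hD]
    ring
  rwa [e₃] at h

theorem integral_sum_integrand :
    ∫ x in (0 : ℝ)..1,
      180 * (8 * ((x ^ 2 + 4) / ((4 - x ^ 2) ^ 2 + 3 * x ^ 2)) - 6 * (1 / (x ^ 2 + 3))) =
      60 * π / √3 := by
  have h3 : √3 ^ 2 = 3 := sq_sqrt (by norm_num)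
  have h3' : √3 ≠ 0 := by positivity
  have hden (x : ℝ) : (4 - x ^ 2) ^ 2 + 3 * x ^ 2 ≠ 0 := by nlinarith [sq_nonneg (x ^ 2 - 5 / 2)]
  have hderiv (x : ℝ) (hx : x ∈ Set.uIcc (0 : ℝ) 1) : HasDerivAt
      (fun x : ℝ => 180 * (8 * (arctan (√3 * x / (4 - x ^ 2)) / √3) - 6 * (arctan (x / √3) / √3)))
      (180 * (8 * ((x ^ 2 + 4) / ((4 - x ^ 2) ^ 2 + 3 * x ^ 2)) - 6 * (1 / (x ^ 2 + 3)))) x := by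
    rw [Set.uIcc_of_le zero_le_one] at hx
    have h4 : 4 - x ^ 2 ≠ 0 := by nlinarith [hx.1, hx.2]
    have d₁ : HasDerivAt (fun x : ℝ => arctan (√3 * x / (4 - x ^ 2)) / √3)
        ((x ^ 2 + 4) / ((4 - x ^ 2) ^ 2 + 3 * x ^ 2)) x := by
      refine (((((hasDerivAt_id x).const_mul √3).div
        ((hasDerivAt_pow 2 x).const_sub 4) h4).arctan).div_const √3).congr_deriv ?_
      have e : 1 + (√3 * x / (4 - x ^ 2)) ^ 2 =
          ((4 - x ^ 2) ^ 2 + 3 * x ^ 2) / (4 - x ^ 2) ^ 2 := by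
        rw [div_pow, mul_pow, h3]
        field_simp
      have := hden x
      simp only [id, Pi.div_apply]
      rw [e]
      field_simp
      ring
    have d₂ : HasDerivAt (fun x : ℝ => arctan (x / √3) / √3) (1 / (x ^ 2 + 3)) x := by
      refine ((((hasDerivAt_id x).div_const √3).arctan).div_const √3).congr_deriv ?_
      simp only [id, div_pow, h3]
      field_simp
      rw [h3]
      ring
    exact ((d₁.const_mul 8).sub (d₂.const_mul 6)).const_mul 180
  have hcont : Continuous fun x : ℝ =>
      180 * (8 * ((x ^ 2 + 4) / ((4 - x ^ 2) ^ 2 + 3 * x ^ 2)) - 6 * (1 / (x ^ 2 + 3))) := by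
    have (x : ℝ) : x ^ 2 + 3 ≠ 0 := by positivity
    fun_prop (disch := assumption)
  rw [intervalIntegral.integral_eq_sub_of_hasDerivAt hderiv (hcont.intervalIntegrable _ _)]
  have e : √3 * 1 / (4 - 1 ^ 2) = 1 / √3 := by
    field_simp
    rw [h3]
    norm_num
  have ht : arctan (1 / √3) = π / 6 := by
    rw [one_div, arctan_inv_sqrt_three]
  rw [e, ht]
  simp
  field_simp
  norm_num

theorem stmt1 :
    Summable (fun n : ℕ =>
      |(Nat.factorial (2 * n) : ℝ) * (130 * (n : ℝ) + 109) /
        (risingFactorial (7 / 6) n * risingFactorial (11 / 6) n * (-1296 : ℝ) ^ n)|) ∧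
    π = Real.sqrt 3 / 60 *
      ∑' n : ℕ,
        (Nat.factorial (2 * n) : ℝ) * (130 * (n : ℝ) + 109) /
          (risingFactorial (7 / 6) n * risingFactorial (11 / 6) n * (-1296 : ℝ) ^ n) := by
  have hmem {x : ℝ} (hx : x ∈ Set.uIoc (0 : ℝ) 1) : x ∈ Set.Icc (0 : ℝ) 1 := by
    rw [Set.uIoc_of_le zero_le_one] at hx
    exact Set.Ioc_subset_Icc_self hx
  simp only [term_eq_integral]
  constructor
  · refine summable_bound.of_nonneg_of_le (fun _ => abs_nonneg _) fun n => ?_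
    have h := intervalIntegral.norm_integral_le_of_norm_le_const (a := 0) (b := 1)
      (f := fun x : ℝ =>
        15 / 2 * (x ^ 2 * (43 + x ^ 2)) * (-(x ^ 2 * (1 - x ^ 2) ^ 2) / 48) ^ n)
      (fun x hx => abs_integrand_le (hmem hx) n)
    rwa [sub_zero, abs_one, mul_one] at h
  · have h := intervalIntegral.hasSum_integral_of_dominated_convergence (a := 0) (b := 1)
      (μ := MeasureTheory.volume)
      (F := fun (n : ℕ) (x : ℝ) =>
        15 / 2 * (x ^ 2 * (43 + x ^ 2)) * (-(x ^ 2 * (1 - x ^ 2) ^ 2) / 48) ^ n)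
      (fun n _ => 330 * (1 / 48) ^ n)
      (fun n => Continuous.aestronglyMeasurable (by fun_prop))
      (fun n => .of_forall fun x hx => abs_integrand_le (hmem hx) n)
      (.of_forall fun _ _ => summable_bound)
      (Continuous.intervalIntegrable (by fun_prop) _ _)
      (.of_forall fun x hx => hasSum_integrand (hmem hx))
    rw [h.tsum_eq, integral_sum_integrand]
    field_simp
end

section
/- π = (√3 / 7776) · Σ_{n=0}^∞ (((4n)!)² (6n)! / ((2n)! (12n)! · 9^{n+1})) · (127169/(12n+1) - 1070/(12n+5) - 131/(12n+7) + 2/(12n+11)), where the series converges absolutely. (The prefactor √3/7776 equals √3/6⁵.) -/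
open Real

/-- Raising the exponent of `y ^ 2` in the integral of `y ^ (2 * k) * (1 - y ^ 2) ^ l`. -/
theorem integral_even_pow_mul_one_sub_sq_pow_succ_left (k l : ℕ) :
    (2 * k + 2 * l + 3 : ℝ) * ∫ y in (0 : ℝ)..1, y ^ (2 * (k + 1)) * (1 - y ^ 2) ^ l =
      (2 * k + 1) * ∫ y in (0 : ℝ)..1, y ^ (2 * k) * (1 - y ^ 2) ^ l := by
  have hderiv : ∀ y ∈ Set.uIcc (0 : ℝ) 1,
      HasDerivAt (fun y : ℝ => y ^ (2 * k + 1) * (1 - y ^ 2) ^ (l + 1))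
        ((2 * k + 1) * (y ^ (2 * k) * (1 - y ^ 2) ^ l) -
          (2 * k + 2 * l + 3) * (y ^ (2 * (k + 1)) * (1 - y ^ 2) ^ l)) y := by
    intro y _
    have h₁ := hasDerivAt_pow (2 * k + 1) y
    have h₂ := (((hasDerivAt_pow 2 y).const_sub 1).fun_pow (l + 1))
    refine (h₁.fun_mul h₂).congr_deriv ?_
    simp only [Nat.add_sub_cancel]
    push_cast
    ring
  have h := intervalIntegral.integral_eq_sub_of_hasDerivAt hderiv
    (Continuous.intervalIntegrable (by fun_prop) _ _)
  rw [intervalIntegral.integral_sub (Continuous.intervalIntegrable (by fun_prop) _ _)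
    (Continuous.intervalIntegrable (by fun_prop) _ _), intervalIntegral.integral_const_mul,
    intervalIntegral.integral_const_mul] at h
  simp at h
  linarith

/-- Raising the exponent of `1 - y ^ 2` in the integral of `y ^ (2 * k) * (1 - y ^ 2) ^ l`. -/
theorem integral_even_pow_mul_one_sub_sq_pow_succ_right (k l : ℕ) :
    (2 * k + 2 * l + 3 : ℝ) * ∫ y in (0 : ℝ)..1, y ^ (2 * k) * (1 - y ^ 2) ^ (l + 1) =
      (2 * l + 2) * ∫ y in (0 : ℝ)..1, y ^ (2 * k) * (1 - y ^ 2) ^ l := by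
  have h : ∫ y in (0 : ℝ)..1, y ^ (2 * k) * (1 - y ^ 2) ^ (l + 1) =
      (∫ y in (0 : ℝ)..1, y ^ (2 * k) * (1 - y ^ 2) ^ l) -
        ∫ y in (0 : ℝ)..1, y ^ (2 * (k + 1)) * (1 - y ^ 2) ^ l := by
    rw [← intervalIntegral.integral_sub (Continuous.intervalIntegrable (by fun_prop) _ _)
      (Continuous.intervalIntegrable (by fun_prop) _ _)]
    congr 1
    funext y
    ring
  rw [h, mul_sub, integral_even_pow_mul_one_sub_sq_pow_succ_left]
  ring

theorem integral_even_pow_mul_one_sub_sq_pow (k l : ℕ) :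
    ∫ y in (0 : ℝ)..1, y ^ (2 * k) * (1 - y ^ 2) ^ l =
      (Nat.factorial (2 * k) * 4 ^ l * Nat.factorial l * Nat.factorial (k + l) : ℝ) /
        (Nat.factorial k * Nat.factorial (2 * (k + l) + 1)) := by
  induction l with
  | zero =>
    have h₁ : (Nat.factorial k : ℝ) ≠ 0 := by positivity
    have h₂ : (Nat.factorial (2 * k) : ℝ) ≠ 0 := by positivity
    simp [Nat.factorial_succ]
    field_simp
  | succ l ih =>
    have h := integral_even_pow_mul_one_sub_sq_pow_succ_right k l
    rw [ih] at h
    have hpos : (2 * k + 2 * l + 3 : ℝ) ≠ 0 := by positivity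
    have hpos' : (2 * (k + l + 1) : ℝ) ≠ 0 := by positivity
    apply mul_left_cancel₀ hpos
    rw [h, ← add_assoc k l 1, show 2 * (k + l + 1) + 1 = 2 * (k + l) + 1 + 1 + 1 by ring,
      Nat.factorial_succ (2 * (k + l) + 1 + 1), Nat.factorial_succ (2 * (k + l) + 1),
      Nat.factorial_succ (k + l), Nat.factorial_succ l]
    have h₁ : (Nat.factorial k : ℝ) ≠ 0 := by positivity
    have h₂ : (Nat.factorial (2 * (k + l) + 1) : ℝ) ≠ 0 := by positivity
    push_cast
    have h₃ : (2 * (k + l) + 1 + 1 + 1 : ℝ) ≠ 0 := by positivity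
    have h₄ : (2 * (k + l) + 1 + 1 : ℝ) ≠ 0 := by positivity
    field_simp
    ring

theorem integral_inv_sq_add_three :
    ∫ y in (0 : ℝ)..1, (y ^ 2 + 3)⁻¹ = π / (6 * √3) := by
  have h3 : (√3) ^ 2 = 3 := Real.sq_sqrt (by norm_num)
  have h0 : √3 ≠ 0 := by positivity
  have hderiv : ∀ y ∈ Set.uIcc (0 : ℝ) 1,
      HasDerivAt (fun y : ℝ => arctan (y / √3) / √3) ((y ^ 2 + 3)⁻¹) y := by
    intro y _
    refine ((((hasDerivAt_id y).div_const (√3)).arctan).div_const (√3)).congr_deriv ?_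
    have hy : y ^ 2 + 3 ≠ 0 := by positivity
    simp only [id, div_pow, h3]
    have : (1 : ℝ) + y ^ 2 / 3 ≠ 0 := by positivity
    field_simp
    rw [h3]
    ring
  rw [intervalIntegral.integral_eq_sub_of_hasDerivAt hderiv]
  · simp only [zero_div, arctan_zero, sub_zero, one_div, arctan_inv_sqrt_three]
    field_simp
  · exact Continuous.intervalIntegrable
      (Continuous.inv₀ (by fun_prop) fun y => by positivity) _ _

theorem integral_geometric_term (n : ℕ) :
    ∫ y in (0 : ℝ)..1, (48 - y ^ 2 * (1 - y ^ 2) ^ 2) * ((y ^ 2) ^ 2 - 5 * y ^ 2 + 16) / 2304 *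
        ((y ^ 2 * (1 - y ^ 2) ^ 2 / 48) ^ 2) ^ n =
      ((Nat.factorial (4 * n) : ℝ) ^ 2 * (Nat.factorial (6 * n) : ℝ) /
          ((Nat.factorial (2 * n) : ℝ) * (Nat.factorial (12 * n) : ℝ) * 9 ^ (n + 1))) *
        (127169 / (12 * (n : ℝ) + 1) - 1070 / (12 * (n : ℝ) + 5) -
          131 / (12 * (n : ℝ) + 7) + 2 / (12 * (n : ℝ) + 11)) / 46656 := by
  set M : ℕ → ℝ := fun j => ∫ y in (0 : ℝ)..1, y ^ (2 * (2 * n + j)) * (1 - y ^ 2) ^ (4 * n)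
    with hM
  have hrec (j : ℕ) : M (j + 1) = (4 * n + 2 * j + 1) / (12 * n + 2 * j + 3) * M j := by
    have h := integral_even_pow_mul_one_sub_sq_pow_succ_left (2 * n + j) (4 * n)
    have hpos : (12 * n + 2 * j + 3 : ℝ) ≠ 0 := by positivity
    rw [div_mul_eq_mul_div, eq_div_iff hpos]
    simp only [hM, ← add_assoc]
    push_cast at h
    linarith
  have hexpand : ∫ y in (0 : ℝ)..1,
      (48 - y ^ 2 * (1 - y ^ 2) ^ 2) * ((y ^ 2) ^ 2 - 5 * y ^ 2 + 16) / 2304 *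
        ((y ^ 2 * (1 - y ^ 2) ^ 2 / 48) ^ 2) ^ n =
      1 / (2304 * 2304 ^ n) *
        (768 * M 0 - 256 * M 1 + 85 * M 2 - 27 * M 3 + 7 * M 4 - M 5) := by
    simp only [hM]
    rw [← intervalIntegral.integral_const_mul, ← intervalIntegral.integral_const_mul,
      ← intervalIntegral.integral_const_mul, ← intervalIntegral.integral_const_mul,
      ← intervalIntegral.integral_const_mul, ← intervalIntegral.integral_sub,
      ← intervalIntegral.integral_add, ← intervalIntegral.integral_sub,
      ← intervalIntegral.integral_add, ← intervalIntegral.integral_sub,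
      ← intervalIntegral.integral_const_mul]
    · congr 1
      funext y
      have h : ((y ^ 2 * (1 - y ^ 2) ^ 2 / 48) ^ 2) ^ n =
          y ^ (2 * (2 * n)) * (1 - y ^ 2) ^ (4 * n) / 2304 ^ n := by
        rw [div_pow, div_pow, mul_pow, mul_pow, ← pow_mul, ← pow_mul, ← pow_mul, ← pow_mul,
          show (48 : ℝ) ^ 2 = 2304 by norm_num]
        ring_nf
      rw [h]
      simp only [mul_add 2 (2 * n), pow_add]
      field_simp
      ring
    all_goals exact Continuous.intervalIntegrable (by fun_prop) _ _
  have h0 : M 0 = 256 ^ n * ((Nat.factorial (4 * n) : ℝ) ^ 2 * Nat.factorial (6 * n) /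
      (Nat.factorial (2 * n) * Nat.factorial (12 * n))) / (12 * n + 1) := by
    simp only [hM, add_zero]
    rw [integral_even_pow_mul_one_sub_sq_pow, show 2 * n + 4 * n = 6 * n by ring,
      show 2 * (6 * n) = 12 * n by ring, show 2 * (2 * n) = 4 * n by ring,
      Nat.factorial_succ, pow_mul]
    push_cast
    norm_num
    have h₁ : (Nat.factorial (2 * n) : ℝ) ≠ 0 := by positivity
    have h₂ : (Nat.factorial (12 * n) : ℝ) ≠ 0 := by positivity
    field_simp
  have h9 : (2304 : ℝ) ^ n = 256 ^ n * 9 ^ n := by rw [← mul_pow]; norm_num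
  rw [hexpand, hrec 4, hrec 3, hrec 2, hrec 1, hrec 0, h0, h9, pow_succ (9 : ℝ) n,
    show ((Nat.factorial (4 * n) : ℝ) ^ 2 * Nat.factorial (6 * n) /
      (Nat.factorial (2 * n) * Nat.factorial (12 * n) * (9 ^ n * 9))) =
      ((Nat.factorial (4 * n) : ℝ) ^ 2 * Nat.factorial (6 * n) /
      (Nat.factorial (2 * n) * Nat.factorial (12 * n))) / (9 ^ n * 9) by rw [div_div]]
  generalize ((Nat.factorial (4 * n) : ℝ) ^ 2 * Nat.factorial (6 * n) /
      (Nat.factorial (2 * n) * Nat.factorial (12 * n))) = r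
  have h₁ : (12 * n + 1 : ℝ) ≠ 0 := by positivity
  have h₃ : (12 * n + 3 : ℝ) = 3 * (4 * n + 1) := by ring
  have h₅ : (12 * n + 5 : ℝ) ≠ 0 := by positivity
  have h₇ : (12 * n + 7 : ℝ) ≠ 0 := by positivity
  have h₉ : (12 * n + 9 : ℝ) = 3 * (4 * n + 3) := by ring
  have h₁₁ : (12 * n + 11 : ℝ) ≠ 0 := by positivity
  have k₁ : (4 * n + 1 : ℝ) ≠ 0 := by positivity
  have k₃ : (4 * n + 3 : ℝ) ≠ 0 := by positivity
  push_cast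
  norm_num [add_assoc]
  rw [h₃, h₉]
  field_simp
  ring

theorem hasSum_factorial_series_pi :
    HasSum (fun n : ℕ =>
      ((Nat.factorial (4 * n) : ℝ) ^ 2 * (Nat.factorial (6 * n) : ℝ) /
          ((Nat.factorial (2 * n) : ℝ) * (Nat.factorial (12 * n) : ℝ) * 9 ^ (n + 1))) *
        (127169 / (12 * (n : ℝ) + 1) - 1070 / (12 * (n : ℝ) + 5) -
          131 / (12 * (n : ℝ) + 7) + 2 / (12 * (n : ℝ) + 11)) / 46656) (π / (6 * √3)) := by
  simp_rw [← integral_geometric_term]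
  rw [← integral_inv_sq_add_three]
  have hq : ∀ y ∈ Set.uIoc (0 : ℝ) 1, 0 ≤ (y ^ 2 * (1 - y ^ 2) ^ 2 / 48) ^ 2 ∧
      (y ^ 2 * (1 - y ^ 2) ^ 2 / 48) ^ 2 ≤ 1 / 2 := by
    intro y hy
    rw [Set.uIoc_of_le zero_le_one] at hy
    have hy₀ : 0 ≤ y ^ 2 := sq_nonneg y
    have hy₁ : y ^ 2 ≤ 1 := pow_le_one₀ hy.1.le hy.2
    have h₁ : (1 - y ^ 2) ^ 2 ≤ 1 := pow_le_one₀ (by linarith) (by linarith)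
    have h₂ : y ^ 2 * (1 - y ^ 2) ^ 2 ≤ 1 := mul_le_one₀ hy₁ (by positivity) h₁
    have h₃ : 0 ≤ y ^ 2 * (1 - y ^ 2) ^ 2 := by positivity
    exact ⟨by positivity, by nlinarith⟩
  refine intervalIntegral.hasSum_integral_of_dominated_convergence
    (fun n y => |(48 - y ^ 2 * (1 - y ^ 2) ^ 2) * ((y ^ 2) ^ 2 - 5 * y ^ 2 + 16) / 2304| *
      (1 / 2) ^ n) (fun n => ?_) (fun n => ?_) ?_ ?_ ?_
  · exact Continuous.aestronglyMeasurable (by fun_prop)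
  · refine Filter.Eventually.of_forall fun y hy => ?_
    rw [norm_mul, Real.norm_eq_abs, Real.norm_eq_abs, abs_pow, abs_of_nonneg (hq y hy).1]
    gcongr
    exact (hq y hy).2
  · exact Filter.Eventually.of_forall fun y _ => summable_geometric_two.mul_left _
  · simp_rw [tsum_mul_left]
    exact Continuous.intervalIntegrable (by fun_prop) _ _
  · refine Filter.Eventually.of_forall fun y hy => ?_
    obtain ⟨h₀, h₁⟩ := hq y hy
    have h := (hasSum_geometric_of_lt_one h₀ (by linarith)).mul_left
      ((48 - y ^ 2 * (1 - y ^ 2) ^ 2) * ((y ^ 2) ^ 2 - 5 * y ^ 2 + 16) / 2304)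
    have hy : y ^ 2 + 3 ≠ 0 := by positivity
    have hne : 1 - (y ^ 2 * (1 - y ^ 2) ^ 2 / 48) ^ 2 ≠ 0 := by linarith
    have hsum : (y ^ 2 + 3)⁻¹ =
        (48 - y ^ 2 * (1 - y ^ 2) ^ 2) * ((y ^ 2) ^ 2 - 5 * y ^ 2 + 16) / 2304 *
          (1 - (y ^ 2 * (1 - y ^ 2) ^ 2 / 48) ^ 2)⁻¹ := by
      rw [← div_eq_mul_inv, eq_div_iff hne, inv_mul_eq_iff_eq_mul₀ hy]
      ring
    rwa [hsum]

theorem stmt6 :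
    Summable (fun n : ℕ =>
      |((Nat.factorial (4 * n) : ℝ) ^ 2 * (Nat.factorial (6 * n) : ℝ) /
          ((Nat.factorial (2 * n) : ℝ) * (Nat.factorial (12 * n) : ℝ) * 9 ^ (n + 1))) *
        (127169 / (12 * (n : ℝ) + 1) - 1070 / (12 * (n : ℝ) + 5) -
          131 / (12 * (n : ℝ) + 7) + 2 / (12 * (n : ℝ) + 11))|) ∧
    π = Real.sqrt 3 / 7776 *
      ∑' n : ℕ,
        ((Nat.factorial (4 * n) : ℝ) ^ 2 * (Nat.factorial (6 * n) : ℝ) /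
            ((Nat.factorial (2 * n) : ℝ) * (Nat.factorial (12 * n) : ℝ) * 9 ^ (n + 1))) *
          (127169 / (12 * (n : ℝ) + 1) - 1070 / (12 * (n : ℝ) + 5) -
            131 / (12 * (n : ℝ) + 7) + 2 / (12 * (n : ℝ) + 11)) := by
  have h := hasSum_factorial_series_pi.mul_right 46656
  simp only [div_mul_cancel₀ _ (show (46656 : ℝ) ≠ 0 by norm_num)] at h
  refine ⟨h.summable.abs, ?_⟩
  rw [h.tsum_eq]
  have h0 : √3 ≠ 0 := by positivity
  field_simp
  norm_num
end

section
/- ∫_0^1 x^{-1/3} (1-x)^{-1/2} / (1 + x/8) dx = 4·√3·π/9. -/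
open Real

/-- An elementary antiderivative of `24 * t / ((8 + t ^ 3) * √(1 - t ^ 3))` on `(0, 1)`. -/
noncomputable def goursatPrimitive (t : ℝ) : ℝ :=
  2 / 3 * ((log (3 * √(1 + t + t ^ 2) + √(1 - t) ^ 3) - log (3 * √(1 + t + t ^ 2) - √(1 - t) ^ 3)) +
    (log (3 - √(1 - t) * √(1 + t + t ^ 2)) - log (3 + √(1 - t) * √(1 + t + t ^ 2)))) -
    4 * √3 / 3 * arctan (√3 * √(1 - t) / √(1 + t + t ^ 2))

theorem one_le_sqrt_one_add_add_sq {t : ℝ} (h0 : 0 ≤ t) : 1 ≤ √(1 + t + t ^ 2) :=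
  one_le_sqrt.2 (by nlinarith)

theorem sqrt_one_sub_le_one {t : ℝ} (h0 : 0 ≤ t) : √(1 - t) ≤ 1 :=
  sqrt_le_one.2 (by linarith)

theorem sqrt_one_sub_pow_three_lt {t : ℝ} (h0 : 0 ≤ t) :
    √(1 - t) ^ 3 < 3 * √(1 + t + t ^ 2) := by
  have := one_le_sqrt_one_add_add_sq h0
  have := pow_le_one₀ (n := 3) (sqrt_nonneg _) (sqrt_one_sub_le_one h0)
  linarith

theorem sqrt_one_sub_mul_sqrt {t : ℝ} (h1 : t ≤ 1) :
    √(1 - t) * √(1 + t + t ^ 2) = √(1 - t ^ 3) := by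
  rw [← sqrt_mul (by linarith)]
  ring_nf

theorem sqrt_one_sub_mul_sqrt_lt {t : ℝ} (h0 : 0 ≤ t) (h1 : t ≤ 1) :
    √(1 - t) * √(1 + t + t ^ 2) < 3 := by
  rw [sqrt_one_sub_mul_sqrt h1]
  have := sqrt_one_sub_le_one (pow_nonneg h0 3)
  linarith

theorem continuousOn_goursatPrimitive : ContinuousOn goursatPrimitive (Set.Icc 0 1) := by
  intro t ⟨h0, h1⟩
  have hq := one_le_sqrt_one_add_add_sq h0
  have hs3 := sqrt_one_sub_pow_three_lt h0
  have hsq := sqrt_one_sub_mul_sqrt_lt h0 h1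
  have hs := sqrt_nonneg (1 - t)
  apply ContinuousAt.continuousWithinAt
  unfold goursatPrimitive
  have e1 : 3 * √(1 + t + t ^ 2) + √(1 - t) ^ 3 ≠ 0 := by positivity
  have e2 : 3 * √(1 + t + t ^ 2) - √(1 - t) ^ 3 ≠ 0 := by linarith
  have e3 : 3 - √(1 - t) * √(1 + t + t ^ 2) ≠ 0 := by linarith
  have e4 : 3 + √(1 - t) * √(1 + t + t ^ 2) ≠ 0 := by positivity
  have e5 : √(1 + t + t ^ 2) ≠ 0 := by positivity
  fun_prop (disch := assumption)

theorem hasDerivAt_goursatPrimitive {t : ℝ} (h0 : 0 < t) (h1 : t < 1) :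
    HasDerivAt goursatPrimitive (24 * t / ((8 + t ^ 3) * √(1 - t ^ 3))) t := by
  have hq := one_le_sqrt_one_add_add_sq h0.le
  have hs3 := sqrt_one_sub_pow_three_lt h0.le
  have hsq := sqrt_one_sub_mul_sqrt_lt h0.le h1.le
  have hs : 0 < √(1 - t) := sqrt_pos.2 (by linarith)
  have ds : HasDerivAt (fun t : ℝ => √(1 - t)) (-1 / (2 * √(1 - t))) t :=
    ((hasDerivAt_id t).const_sub 1).sqrt (by simp; linarith)
  have dq : HasDerivAt (fun t : ℝ => √(1 + t + t ^ 2))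
      ((1 + 2 * t) / (2 * √(1 + t + t ^ 2))) t := by
    have d : HasDerivAt (fun t : ℝ => 1 + t + t ^ 2) (1 + 2 * t) t := by
      convert! ((hasDerivAt_id t).const_add 1).add (hasDerivAt_pow 2 t) using 1
      simp
    exact d.sqrt (by positivity)
  have hs2 : √(1 - t) ^ 2 = 1 - t := sq_sqrt (by linarith)
  have hq2 : √(1 + t + t ^ 2) ^ 2 = 1 + t + t ^ 2 := sq_sqrt (by positivity)
  have h3 : √(3 : ℝ) ^ 2 = 3 := sq_sqrt (by norm_num)
  rw [← sqrt_one_sub_mul_sqrt h1.le]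
  have dA := (((dq.const_mul 3).add (ds.pow 3)).log (by simp; positivity)).sub
    (((dq.const_mul 3).sub (ds.pow 3)).log (by simp; linarith))
  have dB := (((ds.mul dq).const_sub 3).log (by simp; linarith)).sub
    (((ds.mul dq).const_add 3).log (by simp; positivity))
  have dC := ((ds.const_mul √3).div dq (by positivity)).arctan
  convert! ((dA.add dB).const_mul (2 / 3)).sub (dC.const_mul (4 * √3 / 3)) using 1
  simp only [Pi.add_apply, Pi.sub_apply, Pi.mul_apply, Pi.pow_apply, Pi.div_apply]
  generalize √(1 - t) = s at *
  generalize √(1 + t + t ^ 2) = q at *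
  generalize √(3 : ℝ) = r at *
  have hq0 : 0 < q := by linarith
  have p1 : 0 < 3 * q + s ^ 3 := by positivity
  have p2 : 0 < 3 * q - s ^ 3 := by linarith
  have p3 : 0 < 3 - s * q := by linarith
  have p4 : 0 < 3 + s * q := by positivity
  obtain ⟨p, hp⟩ : ∃ p, p = t ^ 2 - 2 * t + 4 := ⟨_, rfl⟩
  have p5 : 0 < p := by rw [hp]; nlinarith [sq_nonneg (t - 1)]
  have p6 : 0 < t + 2 := by linarith
  have p7 : 0 < 8 + t ^ 3 := by positivity
  have hs6 : s ^ 6 = (1 - t) ^ 3 := by rw [← hs2]; ring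
  have hA : (3 * ((1 + 2 * t) / (2 * q)) + (3 : ℕ) * s ^ (3 - 1) * (-1 / (2 * s))) / (3 * q + s ^ 3) -
      (3 * ((1 + 2 * t) / (2 * q)) - (3 : ℕ) * s ^ (3 - 1) * (-1 / (2 * s))) / (3 * q - s ^ 3) =
      -3 * s / (q * (t + 2)) := by
    have hden : (3 * q + s ^ 3) * (3 * q - s ^ 3) = (t + 2) ^ 3 := by
      linear_combination 9 * hq2 - hs6
    rw [div_sub_div _ _ p1.ne' p2.ne', hden]
    field_simp
    push_cast
    linear_combination (-6 * s ^ 2 * (1 + 2 * t)) * hs2 - 18 * s ^ 2 * hq2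
  have hB : -(-1 / (2 * s) * q + s * ((1 + 2 * t) / (2 * q))) / (3 - s * q) -
      (-1 / (2 * s) * q + s * ((1 + 2 * t) / (2 * q))) / (3 + s * q) =
      9 * t ^ 2 / (s * q * (8 + t ^ 3)) := by
    have hden : (3 - s * q) * (3 + s * q) = 8 + t ^ 3 := by
      linear_combination -q ^ 2 * hs2 - (1 - t) * hq2
    rw [div_sub_div _ _ p3.ne' p4.ne', hden]
    field_simp
    linear_combination 6 * hq2 - 6 * (1 + 2 * t) * hs2
  have hC : 1 / (1 + (r * s / q) ^ 2) *
      ((r * (-1 / (2 * s)) * q - r * s * ((1 + 2 * t) / (2 * q))) / q ^ 2) =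
      -r * (2 + 2 * t - t ^ 2) / (2 * (s * q) * p) := by
    have hden : 1 + (r * s / q) ^ 2 = p / q ^ 2 := by
      field_simp
      linear_combination hq2 + s ^ 2 * h3 + 3 * hs2 - hp
    rw [hden]
    field_simp
    linear_combination -r * hq2 - r * (1 + 2 * t) * hs2
  rw [hA, hB, hC]
  have h8 : 8 + t ^ 3 = (t + 2) * p := by rw [hp]; ring
  rw [h8]
  field_simp
  linear_combination 12 * p * hs2 + 12 * (1 - t) * hp - 4 * (t + 2) * (2 + 2 * t - t ^ 2) * h3

theorem hasDerivAt_goursatPrimitive_rpow {x : ℝ} (h0 : 0 < x) (h1 : x < 1) :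
    HasDerivAt (fun x : ℝ => goursatPrimitive (x ^ ((1 : ℝ) / 3)))
      (x ^ (-(1 : ℝ) / 3) * (1 - x) ^ (-(1 : ℝ) / 2) / (1 + x / 8)) x := by
  have hx3 : (x ^ ((1 : ℝ) / 3)) ^ 3 = x := by
    rw [← rpow_natCast, ← rpow_mul h0.le]; norm_num
  have ht0 : 0 < x ^ ((1 : ℝ) / 3) := by positivity
  convert! (hasDerivAt_goursatPrimitive ht0 (rpow_lt_one h0.le h1 (by norm_num))).comp x
    (hasDerivAt_rpow_const (p := 1 / 3) (Or.inl h0.ne')) using 1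
  have e1 : x ^ (-(1 : ℝ) / 3) = x ^ ((1 : ℝ) / 3) * x ^ ((1 : ℝ) / 3 - 1) := by
    rw [← rpow_add h0]; norm_num
  have e2 : (1 - x) ^ (-(1 : ℝ) / 2) = (√(1 - x))⁻¹ := by
    rw [sqrt_eq_rpow, ← rpow_neg (by linarith)]; norm_num
  have hs : 0 < √(1 - x) := sqrt_pos.2 (by linarith)
  rw [hx3, e1, e2]
  field_simp
  norm_num

theorem goursatPrimitive_zero : goursatPrimitive 0 = -(4 * √3 * π / 9) := by
  norm_num [goursatPrimitive, arctan_sqrt_three]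
  ring

theorem goursatPrimitive_one : goursatPrimitive 1 = 0 := by
  simp [goursatPrimitive]

theorem stmt15 :
    ∫ x in (0:ℝ)..1, x ^ (-(1 : ℝ) / 3) * (1 - x) ^ (-(1 : ℝ) / 2) / (1 + x / 8) =
      4 * Real.sqrt 3 * π / 9 := by
  have hc : ContinuousOn (fun x : ℝ => goursatPrimitive (x ^ ((1 : ℝ) / 3))) (Set.Icc 0 1) :=
    continuousOn_goursatPrimitive.comp
      (continuous_rpow_const (by norm_num)).continuousOn
      fun x hx => ⟨rpow_nonneg hx.1 _, rpow_le_one hx.1 hx.2 (by norm_num)⟩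
  have hd : ∀ x ∈ Set.Ioo (0 : ℝ) 1, HasDerivAt _ _ x :=
    fun x hx => hasDerivAt_goursatPrimitive_rpow hx.1 hx.2
  rw [intervalIntegral.integral_eq_sub_of_hasDerivAt_of_le zero_le_one hc hd]
  · norm_num [goursatPrimitive_zero, goursatPrimitive_one]
  · refine intervalIntegral.intervalIntegrable_deriv_of_nonneg
      (by simpa using hc) (by simpa using hd) ?_
    simp only [zero_le_one, min_eq_left, max_eq_right]
    intro x hx
    have := hx.1
    have : 0 < 1 - x := sub_pos.2 hx.2
    positivity
end

section
/- 4 · Σ_{n=0}^∞ 1 / ((2n+1)² · C(2n, n)) = Σ_{n=0}^∞ (6804n⁴ + 17172n³ + 15903n² + 6405n + 956) / ((6n+1)² (6n+3)² (6n+5)² · C(6n, 3n)), where both series converge absolutely. -/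
open Real

/-- The general term of the series on the left-hand side, `1 / ((2n+1)² C(2n, n))`. -/
noncomputable def invSqCentralTerm (n : ℕ) : ℝ :=
  1 / ((2 * (n : ℝ) + 1) ^ 2 * (Nat.choose (2 * n) n : ℝ))

theorem invSqCentralTerm_nonneg (n : ℕ) : 0 ≤ invSqCentralTerm n := by
  unfold invSqCentralTerm
  positivity

theorem summable_invSqCentralTerm : Summable invSqCentralTerm := by
  have h : Summable (fun n : ℕ => 1 / ((n + 1 : ℕ) : ℝ) ^ 2) :=
    (summable_nat_add_iff 1).2 (Real.summable_one_div_nat_pow.2 one_lt_two)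
  refine h.of_nonneg_of_le invSqCentralTerm_nonneg fun n => ?_
  unfold invSqCentralTerm
  have hc : (1 : ℝ) ≤ (Nat.choose (2 * n) n : ℝ) := by
    exact_mod_cast Nat.choose_pos (by lia : n ≤ 2 * n)
  have hn : (0 : ℝ) ≤ n := n.cast_nonneg
  push_cast
  apply one_div_le_one_div_of_le (by positivity)
  calc ((n : ℝ) + 1) ^ 2 ≤ (2 * (n : ℝ) + 1) ^ 2 := by gcongr; linarith
    _ ≤ (2 * (n : ℝ) + 1) ^ 2 * (Nat.choose (2 * n) n : ℝ) :=
      le_mul_of_one_le_right (by positivity) hc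

theorem choose_two_mul_succ (k : ℕ) :
    (Nat.choose (2 * (k + 1)) (k + 1) : ℝ) =
      2 * (2 * (k : ℝ) + 1) / ((k : ℝ) + 1) * (Nat.choose (2 * k) k : ℝ) := by
  have h : ((k : ℝ) + 1) * (Nat.choose (2 * (k + 1)) (k + 1) : ℝ) =
      2 * (2 * (k : ℝ) + 1) * (Nat.choose (2 * k) k : ℝ) := by
    exact_mod_cast Nat.succ_mul_centralBinom_succ k
  field_simp
  linarith

/-- The sum of three consecutive terms, put over a common denominator. -/
theorem four_mul_three_invSqCentralTerm (n : ℕ) :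
    4 * (invSqCentralTerm (3 * n) + invSqCentralTerm (3 * n + 1) +
      invSqCentralTerm (3 * n + 2)) =
    (6804 * (n : ℝ) ^ 4 + 17172 * (n : ℝ) ^ 3 + 15903 * (n : ℝ) ^ 2 + 6405 * (n : ℝ) + 956) /
      ((6 * (n : ℝ) + 1) ^ 2 * (6 * (n : ℝ) + 3) ^ 2 * (6 * (n : ℝ) + 5) ^ 2 *
        (Nat.choose (6 * n) (3 * n) : ℝ)) := by
  have hc : (0 : ℝ) < (Nat.choose (6 * n) (3 * n) : ℝ) := by
    exact_mod_cast Nat.choose_pos (by lia : 3 * n ≤ 6 * n)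
  unfold invSqCentralTerm
  rw [choose_two_mul_succ (3 * n + 1), choose_two_mul_succ (3 * n),
    show 2 * (3 * n) = 6 * n by ring]
  push_cast
  rw [show 2 * (3 * (n : ℝ)) + 1 = 6 * n + 1 by ring,
    show 2 * (3 * (n : ℝ) + 1) + 1 = 6 * n + 3 by ring,
    show 2 * (3 * (n : ℝ) + 2) + 1 = 6 * n + 5 by ring,
    show 3 * (n : ℝ) + 1 + 1 = 3 * n + 2 by ring]
  field_simp
  ring

theorem hasSum_three_mul {f : ℕ → ℝ} (hf : Summable f) :
    HasSum (fun n => f (3 * n) + f (3 * n + 1) + f (3 * n + 2)) (∑' n, f n) := by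
  have hs (r : ℕ) : Summable (fun n => f (3 * n + r)) :=
    hf.comp_injective fun a b h => by simpa using h
  have hsum : Summable (fun n => f (3 * n) + f (3 * n + 1) + f (3 * n + 2)) :=
    ((hs 0).add (hs 1)).add (hs 2)
  have hlim := hf.hasSum.tendsto_sum_nat.comp
    (Filter.tendsto_id.const_mul_atTop' (by norm_num : 0 < 3))
  refine (hsum.hasSum_iff_tendsto_nat).2 (hlim.congr fun N => ?_)
  induction N with
  | zero => simp
  | succ N ih =>
    rw [Finset.sum_range_succ, ← ih]
    simp only [Function.comp_apply, id_eq, mul_add, mul_one, Finset.sum_range_succ]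
    ring

theorem stmt18 :
    Summable (fun n : ℕ =>
      |1 / ((2 * (n : ℝ) + 1) ^ 2 * (Nat.choose (2 * n) n : ℝ))|) ∧
    Summable (fun n : ℕ =>
      |(6804 * (n : ℝ) ^ 4 + 17172 * (n : ℝ) ^ 3 + 15903 * (n : ℝ) ^ 2 + 6405 * (n : ℝ) + 956) /
        ((6 * (n : ℝ) + 1) ^ 2 * (6 * (n : ℝ) + 3) ^ 2 * (6 * (n : ℝ) + 5) ^ 2 *
          (Nat.choose (6 * n) (3 * n) : ℝ))|) ∧
    4 * ∑' n : ℕ, 1 / ((2 * (n : ℝ) + 1) ^ 2 * (Nat.choose (2 * n) n : ℝ)) =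
      ∑' n : ℕ,
        (6804 * (n : ℝ) ^ 4 + 17172 * (n : ℝ) ^ 3 + 15903 * (n : ℝ) ^ 2 + 6405 * (n : ℝ) + 956) /
          ((6 * (n : ℝ) + 1) ^ 2 * (6 * (n : ℝ) + 3) ^ 2 * (6 * (n : ℝ) + 5) ^ 2 *
            (Nat.choose (6 * n) (3 * n) : ℝ)) := by
  have h := (hasSum_three_mul summable_invSqCentralTerm).mul_left 4
  simp only [four_mul_three_invSqCentralTerm] at h
  exact ⟨summable_invSqCentralTerm.abs, h.summable.abs, h.tsum_eq.symm⟩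
end

section
/- 36 · √3 · (Γ(1/4))² / π^{3/2} = Σ_{n=0}^∞ (640n² + 608n + 147) · (8n)! / (((2n+1)!)² · (4n)! · 24^{4n}), where the series converges absolutely. -/
open Real

theorem multichoose_one_half_eq_centralBinom_div (n : ℕ) :
    Ring.multichoose (1 / 2 : ℝ) n = (n.centralBinom : ℝ) / 4 ^ n := by
  have key : ∀ m : ℕ, (ascPochhammer ℝ m).eval (1 / 2 : ℝ) =
      (m.factorial : ℝ) * ((m.centralBinom : ℝ) / 4 ^ m) := by
    intro m
    induction m with
    | zero => simp
    | succ k ih =>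
      have h : ((k : ℝ) + 1) * ((k + 1).centralBinom : ℝ) = 2 * (2 * k + 1) * k.centralBinom := by
        exact_mod_cast Nat.succ_mul_centralBinom_succ k
      rw [ascPochhammer_succ_right, Polynomial.eval_mul, ih, Nat.factorial_succ]
      simp only [Polynomial.eval_add, Polynomial.eval_X, Polynomial.eval_natCast]
      push_cast
      rw [pow_succ]
      field_simp
      linear_combination -2 * h
  have h := Ring.factorial_nsmul_multichoose_eq_ascPochhammer (1 / 2 : ℝ) n
  rw [Polynomial.ascPochhammer_smeval_eq_eval, key, nsmul_eq_mul] at h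
  exact mul_left_cancel₀ (by positivity) h

theorem hasSum_centralBinom_div_four_pow_mul_pow {x : ℝ} (hx : |x| < 1) :
    HasSum (fun n : ℕ => (n.centralBinom : ℝ) / 4 ^ n * x ^ n) (1 / √(1 - x)) := by
  have h := (Real.one_div_one_sub_rpow_hasFPowerSeriesOnBall_zero (1 / 2)).hasSum
    (y := x) (by simpa [enorm_eq_nnnorm, ← NNReal.coe_lt_coe] using hx)
  simpa only [zero_add, FormalMultilinearSeries.ofScalars_apply_eq, smul_eq_mul,
    ← Ring.multichoose_eq, multichoose_one_half_eq_centralBinom_div, ← Real.sqrt_eq_rpow] using h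

theorem integral_cos_pow_even_zero_pi (k : ℕ) :
    ∫ x in (0 : ℝ)..π, cos x ^ (2 * k) = π * ((k.centralBinom : ℝ) / 4 ^ k) := by
  induction k with
  | zero => simp
  | succ k ih =>
    have h : ((k : ℝ) + 1) * ((k + 1).centralBinom : ℝ) = 2 * (2 * k + 1) * k.centralBinom := by
      exact_mod_cast Nat.succ_mul_centralBinom_succ k
    have h' : ((k + 1).centralBinom : ℝ) = 2 * (2 * k + 1) * k.centralBinom / (k + 1) := by
      rw [← h]; field_simp
    rw [mul_add_one, integral_cos_pow, ih, pow_succ, h']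
    push_cast
    simp only [sin_pi, sin_zero, mul_zero, sub_zero, zero_div, zero_add]
    field_simp
    ring

theorem integral_cos_pow_odd_zero_pi (k : ℕ) :
    ∫ x in (0 : ℝ)..π, cos x ^ (2 * k + 1) = 0 := by
  induction k with
  | zero => simp
  | succ k ih =>
    rw [show 2 * (k + 1) + 1 = 2 * k + 1 + 2 by ring, integral_cos_pow, ih]
    simp

theorem hasSum_integral_one_div_sqrt_one_sub_mul_cos {c : ℝ} (hc : |c| < 1) :
    HasSum (fun k : ℕ => ((2 * k).centralBinom : ℝ) / 4 ^ (2 * k) *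
      ((k.centralBinom : ℝ) / 4 ^ k) * c ^ (2 * k))
      (1 / π * ∫ θ in (0 : ℝ)..π, 1 / √(1 - c * cos θ)) := by
  have hle : ∀ θ, |c * cos θ| ≤ |c| := fun θ => by
    rw [abs_mul]; exact mul_le_of_le_one_right (abs_nonneg _) (abs_cos_le_one θ)
  have h : HasSum (fun m : ℕ => ∫ θ in (0 : ℝ)..π,
      (m.centralBinom : ℝ) / 4 ^ m * (c * cos θ) ^ m)
      (∫ θ in (0 : ℝ)..π, 1 / √(1 - c * cos θ)) := by
    refine intervalIntegral.hasSum_integral_of_dominated_convergence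
      (fun m _ => |c| ^ m) (fun m => ?_) (fun m => ?_) ?_ ?_ ?_
    · exact Continuous.aestronglyMeasurable (by fun_prop)
    · refine .of_forall fun θ _ => ?_
      have hb : (m.centralBinom : ℝ) / 4 ^ m ≤ 1 :=
        div_le_one_of_le₀ (by exact_mod_cast m.centralBinom_le_four_pow) (by positivity)
      rw [norm_mul, norm_pow, Real.norm_of_nonneg (by positivity : (0 : ℝ) ≤ _ / 4 ^ m),
        Real.norm_eq_abs]
      exact (mul_le_mul hb (pow_le_pow_left₀ (abs_nonneg _) (hle θ) m) (by positivity)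
        zero_le_one).trans_eq (one_mul _)
    · exact .of_forall fun _ _ => summable_geometric_of_lt_one (abs_nonneg _) hc
    · exact intervalIntegrable_const
    · exact .of_forall fun θ _ =>
        hasSum_centralBinom_div_four_pow_mul_pow ((hle θ).trans_lt hc)
  have hinj : Function.Injective fun k : ℕ => 2 * k := fun a b hab => by simpa using hab
  rw [← hinj.hasSum_iff] at h
  · refine (congrArg (HasSum · _) (funext fun k => ?_)).mpr (h.mul_left (1 / π))
    simp only [Function.comp_apply, mul_pow, intervalIntegral.integral_const_mul,
      integral_cos_pow_even_zero_pi]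
    field_simp
  · intro m hm
    obtain ⟨k, rfl⟩ : Odd m := by
      rw [← Nat.not_even_iff_odd]
      rintro ⟨k, rfl⟩
      exact hm ⟨k, by simp [two_mul]⟩
    simp only [mul_pow, intervalIntegral.integral_const_mul, integral_cos_pow_odd_zero_pi,
      mul_zero]

theorem integral_rpow_mul_one_sub_rpow {a b : ℝ} (ha : 0 < a) (hb : 0 < b) :
    ∫ x in Set.Ioo (0 : ℝ) 1, x ^ (a - 1) * (1 - x) ^ (b - 1) =
      Gamma a * Gamma b / Gamma (a + b) := by
  have h : (Complex.betaIntegral a b) =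
      ((∫ x in Set.Ioo (0 : ℝ) 1, x ^ (a - 1) * (1 - x) ^ (b - 1) : ℝ) : ℂ) := by
    rw [Complex.betaIntegral, intervalIntegral.integral_of_le zero_le_one,
      MeasureTheory.integral_Ioc_eq_integral_Ioo, ← integral_complex_ofReal]
    refine MeasureTheory.setIntegral_congr_fun measurableSet_Ioo fun x hx => ?_
    have h1 : (0 : ℝ) ≤ 1 - x := by linarith [hx.2]
    rw [Complex.ofReal_mul, Complex.ofReal_cpow hx.1.le, Complex.ofReal_cpow h1]
    push_cast
    rfl
  have h' := ProbabilityTheory.beta_eq_betaIntegralReal a b ha hb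
  rw [h, Complex.ofReal_re] at h'
  exact h'.symm

theorem image_Ioo_zero_pi_one_sub_cos_div_two_sq :
    (fun θ : ℝ => ((1 - cos θ) / 2) ^ 2) '' Set.Ioo 0 π = Set.Ioo 0 1 := by
  ext x
  constructor
  · rintro ⟨θ, hθ, rfl⟩
    have hs := sin_pos_of_mem_Ioo hθ
    have := sin_sq_add_cos_sq θ
    have h1 : cos θ < 1 := by nlinarith
    have h2 : -1 < cos θ := by nlinarith
    constructor <;> simp only <;> nlinarith
  · intro hx
    have h0 : 0 < √x := sqrt_pos.2 hx.1
    have h1 : √x < 1 := by rw [sqrt_lt' one_pos]; simpa using hx.2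
    refine ⟨arccos (1 - 2 * √x), ⟨arccos_pos.2 (by linarith), ?_⟩, ?_⟩
    · refine lt_of_le_of_ne (arccos_le_pi _) fun h => ?_
      rw [arccos_eq_pi] at h
      linarith
    · simp only
      rw [cos_arccos (by linarith) (by linarith)]
      ring_nf
      exact sq_sqrt hx.1.le

theorem injOn_Ioo_zero_pi_one_sub_cos_div_two_sq :
    Set.InjOn (fun θ : ℝ => ((1 - cos θ) / 2) ^ 2) (Set.Ioo 0 π) := by
  intro a ha b hb hab
  refine injOn_cos (Set.Ioo_subset_Icc_self ha) (Set.Ioo_subset_Icc_self hb) ?_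
  have := (sq_eq_sq₀ (by linarith [cos_le_one a]) (by linarith [cos_le_one b])).1 hab
  linarith

theorem integral_one_div_sqrt_three_sub_cos :
    ∫ θ in (0 : ℝ)..π, 1 / √(3 - cos θ) = Gamma (1 / 4) ^ 2 / (4 * √π) := by
  have hbeta := integral_rpow_mul_one_sub_rpow (a := 1 / 4) (b := 1 / 2) (by norm_num) (by norm_num)
  rw [← image_Ioo_zero_pi_one_sub_cos_div_two_sq,
    MeasureTheory.integral_image_eq_integral_abs_deriv_smul
      (f' := fun θ => (1 - cos θ) / 2 * sin θ) measurableSet_Ioo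
      (fun θ _ => by
        refine HasDerivAt.hasDerivWithinAt ?_
        convert! ((((hasDerivAt_cos θ).const_sub 1).div_const 2).pow 2) using 1
        simp; ring)
      injOn_Ioo_zero_pi_one_sub_cos_div_two_sq] at hbeta
  have hint : ∫ θ in (0 : ℝ)..π, 1 / √(3 - cos θ) =
      1 / (2 * √2) * (Gamma (1 / 4) * Gamma (1 / 2) / Gamma (1 / 4 + 1 / 2)) := by
    rw [← hbeta, intervalIntegral.integral_of_le pi_pos.le,
      MeasureTheory.integral_Ioc_eq_integral_Ioo, ← MeasureTheory.integral_const_mul]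
    refine MeasureTheory.setIntegral_congr_fun measurableSet_Ioo fun θ hθ => ?_
    have hs := sin_pos_of_mem_Ioo hθ
    have hsc := sin_sq_add_cos_sq θ
    have h1 : cos θ < 1 := by nlinarith
    have h2 : -1 < cos θ := by nlinarith
    simp only [smul_eq_mul]
    set c := (1 - cos θ) / 2 with hc
    have hcos : cos θ = 1 - 2 * c := by rw [hc]; ring
    have hc0 : 0 < c := by linarith
    have hc1 : 0 < 1 - c := by linarith
    have hsin : sin θ = 2 * √c * √(1 - c) := by
      rw [← sq_eq_sq₀ hs.le (by positivity), mul_pow, mul_pow, sq_sqrt hc0.le, sq_sqrt hc1.le]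
      rw [hcos] at hsc
      linear_combination hsc
    have e1 : (c ^ 2) ^ ((1 : ℝ) / 4 - 1) = 1 / (c * √c) := by
      rw [← rpow_natCast, ← rpow_mul hc0.le, Real.sqrt_eq_rpow, ← rpow_one_add' hc0.le (by norm_num),
        one_div (c ^ _), ← rpow_neg hc0.le]
      norm_num
    have e2 : (1 - c ^ 2) ^ ((1 : ℝ) / 2 - 1) = 1 / (√(1 - c) * √(1 + c)) := by
      rw [← sqrt_mul hc1.le, Real.sqrt_eq_rpow, one_div (_ ^ _), ← rpow_neg (by positivity)]
      congr 1 <;> ring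
    have e3 : √(3 - cos θ) = √2 * √(1 + c) := by
      rw [← sqrt_mul (by norm_num), hcos]; ring_nf
    rw [abs_of_pos (by positivity), e1, e2, e3, hsin]
    have : 0 < √(1 - c) := sqrt_pos.2 hc1
    have : 0 < √(1 + c) := sqrt_pos.2 (by linarith)
    field_simp
  have hrefl : Gamma (1 / 4) * Gamma (1 / 4 + 1 / 2) = π * √2 := by
    have := Gamma_mul_Gamma_one_sub (1 / 4)
    rw [show (1 : ℝ) - 1 / 4 = 1 / 4 + 1 / 2 by norm_num, mul_one_div, sin_pi_div_four] at this
    rw [this]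
    field_simp
    norm_num
  have hG : 0 < Gamma (1 / 4) := Gamma_pos_of_pos (by norm_num)
  have hG' : Gamma (1 / 4 + 1 / 2) = π * √2 / Gamma (1 / 4) := by
    rw [← hrefl]; field_simp
  rw [hint, hG', Gamma_one_half_eq]
  have h2 : √2 ^ 2 = 2 := sq_sqrt (by norm_num)
  have hp : √π ^ 2 = π := sq_sqrt pi_pos.le
  field_simp
  rw [h2, hp]
  ring

theorem one_div_pi_mul_integral_one_div_sqrt_one_sub_third_mul_cos :
    1 / π * ∫ θ in (0 : ℝ)..π, 1 / √(1 - 1 / 3 * cos θ) =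
      √3 * Gamma (1 / 4) ^ 2 / (4 * π ^ ((3 : ℝ) / 2)) := by
  have h (θ : ℝ) : 1 / √(1 - 1 / 3 * cos θ) = √3 * (1 / √(3 - cos θ)) := by
    rw [show 1 - 1 / 3 * cos θ = (3 - cos θ) / 3 by ring, sqrt_div' _ (by norm_num)]
    field_simp
  have hpi : π ^ ((3 : ℝ) / 2) = π * √π := by
    rw [Real.sqrt_eq_rpow, ← rpow_one_add' pi_pos.le (by norm_num)]
    norm_num
  simp only [h, intervalIntegral.integral_const_mul, integral_one_div_sqrt_three_sub_cos, hpi]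
  field_simp

theorem centralBinom_cast_eq (n : ℕ) :
    (n.centralBinom : ℝ) = ((2 * n).factorial : ℝ) / (n.factorial : ℝ) ^ 2 := by
  rw [Nat.centralBinom, Nat.cast_choose ℝ (by omega), two_mul, Nat.add_sub_cancel, sq]

theorem centralBinom_mul_centralBinom_mul_pow (k : ℕ) :
    ((2 * k).centralBinom : ℝ) / 4 ^ (2 * k) * ((k.centralBinom : ℝ) / 4 ^ k) *
      (1 / 3) ^ (2 * k) =
    ((4 * k).factorial : ℝ) / ((k.factorial : ℝ) ^ 2 * ((2 * k).factorial : ℝ) * 24 ^ (2 * k)) := by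
  rw [centralBinom_cast_eq, centralBinom_cast_eq, show 2 * (2 * k) = 4 * k by ring]
  have h : (24 : ℝ) ^ (2 * k) = 4 ^ (2 * k) * 4 ^ k * 3 ^ (2 * k) := by
    simp only [pow_mul]
    rw [← mul_pow, ← mul_pow]; norm_num
  rw [h, div_pow, one_pow]
  field_simp

theorem HasSum.mul_even_add_odd {a f : ℕ → ℝ} {s : ℝ} (h : HasSum a s) (c : ℝ)
    (hf : ∀ n, f n = c * (a (2 * n) + a (2 * n + 1))) : HasSum f (c * s) := by
  have he := h.summable.comp_injective (i := fun k : ℕ => 2 * k) fun a b hab => by simpa using hab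
  have ho := h.summable.comp_injective (i := fun k : ℕ => 2 * k + 1)
    fun a b hab => by simpa using hab
  rw [funext hf, ← h.tsum_eq, ← tsum_even_add_odd he ho]
  exact (he.hasSum.add ho.hasSum).mul_left c

theorem quadratic_mul_factorial_div_eq (n : ℕ) :
    (640 * (n : ℝ) ^ 2 + 608 * (n : ℝ) + 147) * (Nat.factorial (8 * n) : ℝ) /
        ((Nat.factorial (2 * n + 1) : ℝ) ^ 2 * (Nat.factorial (4 * n) : ℝ) * 24 ^ (4 * n)) =
    144 * (((4 * (2 * n)).factorial : ℝ) /
        (((2 * n).factorial : ℝ) ^ 2 * ((2 * (2 * n)).factorial : ℝ) * 24 ^ (2 * (2 * n))) +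
      ((4 * (2 * n + 1)).factorial : ℝ) / (((2 * n + 1).factorial : ℝ) ^ 2 *
        ((2 * (2 * n + 1)).factorial : ℝ) * 24 ^ (2 * (2 * n + 1)))) := by
  rw [show 4 * (2 * n + 1) = 8 * n + 1 + 1 + 1 + 1 by ring,
    show 2 * (2 * n + 1) = 4 * n + 1 + 1 by ring, show 4 * (2 * n) = 8 * n by ring,
    show 2 * (2 * n) = 4 * n by ring]
  simp only [Nat.factorial_succ, pow_succ (24 : ℝ)]
  push_cast
  field_simp
  ring

theorem stmt19 :
    Summable (fun n : ℕ =>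
      |(640 * (n : ℝ) ^ 2 + 608 * (n : ℝ) + 147) * (Nat.factorial (8 * n) : ℝ) /
        ((Nat.factorial (2 * n + 1) : ℝ) ^ 2 * (Nat.factorial (4 * n) : ℝ) * 24 ^ (4 * n))|) ∧
    36 * Real.sqrt 3 * (Real.Gamma (1 / 4)) ^ 2 / π ^ ((3 : ℝ) / 2) =
      ∑' n : ℕ,
        (640 * (n : ℝ) ^ 2 + 608 * (n : ℝ) + 147) * (Nat.factorial (8 * n) : ℝ) /
          ((Nat.factorial (2 * n + 1) : ℝ) ^ 2 * (Nat.factorial (4 * n) : ℝ) * 24 ^ (4 * n)) := by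
  have h := hasSum_integral_one_div_sqrt_one_sub_mul_cos (c := 1 / 3) (by norm_num [abs_of_pos])
  rw [one_div_pi_mul_integral_one_div_sqrt_one_sub_third_mul_cos] at h
  simp only [centralBinom_mul_centralBinom_mul_pow] at h
  have hsum := h.mul_even_add_odd 144 quadratic_mul_factorial_div_eq
  refine ⟨hsum.summable.abs, Eq.trans ?_ hsum.tsum_eq.symm⟩
  ring
end
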